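/- Let a, d be real numbers. For every integer n ≥ 0 and every real number t, the general Eulerian polynomial satisfies T_n(t,a,d) = ∑_{j=0}^n C(n, j) d^j A_j(t) (at - a)^{n-j}, where A_j(t) are the traditional Eulerian polynomials and C denotes the binomial coefficient. -/

import Mathlib

open scoped Classical

/-- Number of ascents of a permutation of `Fin n`:
positions `j` with `j + 1 < n` and `π j < π (j+1)`. -/
noncomputable def ascentCount {n : ℕ} (π : Equiv.Perm (Fin n)) : ℕ :=
  ((Finset.range (n - 1)).filter (fun j =>
    ∃ h : j + 1 < n, π ⟨j, Nat.lt_of_succ_lt h⟩ < π ⟨j + 1, h⟩)).card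

/-- The Eulerian number `A_{n,k}`: the number of permutations of an `n`-element
linearly ordered set with exactly `k` ascents. -/
noncomputable def eulerian (n k : ℕ) : ℕ :=
  (Finset.univ.filter (fun π : Equiv.Perm (Fin n) => ascentCount π = k)).card

/-- The `n`-th Eulerian polynomial `A_n(t) = ∑_{k=0}^{n-1} A_{n,k} t^k`, with `A_0(t) = 1`. -/
noncomputable def eulerianPoly (n : ℕ) (t : ℝ) : ℝ :=
  if n = 0 then 1 else ∑ k ∈ Finset.range n, (eulerian n k : ℝ) * t ^ k

/-- General Eulerian numbers `A_{n,k}(a,d)` for the arithmetic progression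
`a, a+d, a+2d, …`: `A_{0,-1}(a,d) = 1`, `A_{n,k}(a,d) = 0` for `k ≥ n` or `k ≤ -2`, and
`A_{n,k}(a,d) = (-a+(k+2)d) A_{n-1,k}(a,d) + (a+(n-k-1)d) A_{n-1,k-1}(a,d)` for `n ≥ 1`. -/
noncomputable def genEulerian (a d : ℝ) : ℕ → ℤ → ℝ
  | 0, k => if k = -1 then 1 else 0
  | (n + 1), k =>
      if ((n : ℤ) + 1 ≤ k ∨ k ≤ -2) then 0
      else (-a + ((k : ℝ) + 2) * d) * genEulerian a d n k
        + (a + (((n : ℝ) + 1) - (k : ℝ) - 1) * d) * genEulerian a d n (k - 1)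

/-- General Eulerian polynomial `T_n(t,a,d) = ∑_{k=-1}^{n-1} A_{n,k}(a,d) t^{k+1}`
(which equals `1` when `n = 0`). -/
noncomputable def genEulerianPoly (n : ℕ) (t a d : ℝ) : ℝ :=
  ∑ k ∈ Finset.range (n + 1), genEulerian a d n ((k : ℤ) - 1) * t ^ k

open Polynomial

/-- `IsAscent π j` says that `j` is the position of an ascent of `π`. -/
def IsAscent {n : ℕ} (π : Equiv.Perm (Fin n)) (j : ℕ) : Prop :=
  ∃ h : j + 1 < n, π ⟨j, Nat.lt_of_succ_lt h⟩ < π ⟨j + 1, h⟩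

theorem ascentCount_eq_sum {n : ℕ} (π : Equiv.Perm (Fin n)) :
    ascentCount π = ∑ j ∈ Finset.range n, if IsAscent π j then 1 else 0 := by
  rcases n with _ | n
  · simp [ascentCount]
  · have h : ¬ IsAscent π n := fun ⟨h, _⟩ => by omega
    rw [Finset.sum_range_succ, if_neg h, add_zero, ← Finset.card_filter, ascentCount]
    congr

theorem ascentCount_le {n : ℕ} (π : Equiv.Perm (Fin n)) : ascentCount π ≤ n - 1 :=
  (Finset.card_filter_le _ _).trans (by simp)

/-- Insert the new largest value at position `p` of the permutation `σ`. -/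
def insertMax {n : ℕ} (p : Fin (n + 1)) (σ : Equiv.Perm (Fin n)) : Equiv.Perm (Fin (n + 1)) :=
  (finSuccEquiv' p).trans ((Equiv.optionCongr σ).trans (finSuccEquiv' (Fin.last n)).symm)

@[simp]
theorem insertMax_apply_self {n : ℕ} (p : Fin (n + 1)) (σ : Equiv.Perm (Fin n)) :
    insertMax p σ p = Fin.last n := by
  simp [insertMax]

@[simp]
theorem insertMax_apply_succAbove {n : ℕ} (p : Fin (n + 1)) (σ : Equiv.Perm (Fin n)) (i : Fin n) :
    insertMax p σ (p.succAbove i) = (σ i).castSucc := by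
  simp [insertMax]

theorem insertMax_apply_of_lt {n : ℕ} (p : Fin (n + 1)) (σ : Equiv.Perm (Fin n)) {j : ℕ}
    (hj : j < p) (h : j < n + 1) :
    insertMax p σ ⟨j, h⟩ = (σ ⟨j, by omega⟩).castSucc := by
  rw [← insertMax_apply_succAbove p, Fin.succAbove_of_castSucc_lt _ _ (by simpa [Fin.lt_def])]
  rfl

theorem insertMax_apply_succ_of_le {n : ℕ} (p : Fin (n + 1)) (σ : Equiv.Perm (Fin n)) {j : ℕ}
    (hj : p ≤ j) (h : j + 1 < n + 1) :
    insertMax p σ ⟨j + 1, h⟩ = (σ ⟨j, by omega⟩).castSucc := by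
  rw [← insertMax_apply_succAbove p, Fin.succAbove_of_le_castSucc _ _ (by simpa [Fin.le_def])]
  rfl

theorem insertMax_bijective (n : ℕ) :
    Function.Bijective fun x : Fin (n + 1) × Equiv.Perm (Fin n) => insertMax x.1 x.2 := by
  rw [Fintype.bijective_iff_injective_and_card]
  refine ⟨?_, by simp [Fintype.card_perm, Nat.factorial_succ]⟩
  rintro ⟨p, σ⟩ ⟨q, τ⟩ h
  have h : insertMax p σ = insertMax q τ := h
  obtain rfl : p = q := (insertMax q τ).injective <| by
    rw [insertMax_apply_self, ← h, insertMax_apply_self]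
  congr
  ext1 i
  have := DFunLike.congr_fun h (p.succAbove i)
  simpa using this

theorem isAscent_insertMax_of_succ_lt {n : ℕ} (p : Fin (n + 1)) (σ : Equiv.Perm (Fin n)) {j : ℕ}
    (hj : j + 1 < p) : IsAscent (insertMax p σ) j ↔ IsAscent σ j := by
  have hp := p.isLt
  unfold IsAscent
  rw [exists_prop_of_true (show j + 1 < n + 1 by omega),
    exists_prop_of_true (show j + 1 < n by omega),
    insertMax_apply_of_lt p σ (by omega), insertMax_apply_of_lt p σ hj, Fin.castSucc_lt_castSucc_iff]

theorem isAscent_insertMax_of_succ_eq {n : ℕ} (p : Fin (n + 1)) (σ : Equiv.Perm (Fin n)) {j : ℕ}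
    (hj : j + 1 = p) : IsAscent (insertMax p σ) j := by
  refine ⟨by omega, ?_⟩
  have : (⟨j + 1, by omega⟩ : Fin (n + 1)) = p := Fin.ext hj
  rw [this, insertMax_apply_self, insertMax_apply_of_lt p σ (by omega)]
  exact Fin.castSucc_lt_last _

theorem not_isAscent_insertMax_self {n : ℕ} (p : Fin (n + 1)) (σ : Equiv.Perm (Fin n)) :
    ¬ IsAscent (insertMax p σ) p := by
  rintro ⟨h, hlt⟩
  rw [Fin.eta, insertMax_apply_self] at hlt
  exact (Fin.le_last _).not_gt hlt

theorem isAscent_insertMax_succ {n : ℕ} (p : Fin (n + 1)) (σ : Equiv.Perm (Fin n)) {j : ℕ}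
    (hj : p ≤ j) : IsAscent (insertMax p σ) (j + 1) ↔ IsAscent σ j := by
  unfold IsAscent
  by_cases h : j + 1 < n
  · rw [exists_prop_of_true (show j + 1 + 1 < n + 1 by omega), exists_prop_of_true h,
      insertMax_apply_succ_of_le p σ hj, insertMax_apply_succ_of_le p σ (by omega),
      Fin.castSucc_lt_castSucc_iff]
  · exact iff_of_false (fun ⟨h', _⟩ => h (by omega)) fun ⟨h', _⟩ => h h'

theorem ascentCount_insertMax_zero {n : ℕ} (σ : Equiv.Perm (Fin n)) :
    ascentCount (insertMax 0 σ) = ascentCount σ := by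
  rw [ascentCount_eq_sum, ascentCount_eq_sum, Finset.sum_range_succ',
    if_neg (by exact not_isAscent_insertMax_self 0 σ), add_zero]
  exact Finset.sum_congr rfl fun j _ => by rw [isAscent_insertMax_succ 0 σ (by simp)]

theorem sum_range_succ_add_of_insert {n i : ℕ} (hi : i < n) {f g : ℕ → ℕ}
    (hlt : ∀ j < i, g j = f j) (hself : g i = 1) (hsucc : g (i + 1) = 0)
    (hgt : ∀ j, i < j → g (j + 1) = f j) :
    ∑ j ∈ Finset.range (n + 1), g j + f i = ∑ j ∈ Finset.range n, f j + 1 := by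
  induction n, hi using Nat.le_induction with
  | base =>
    rw [Finset.sum_range_succ, Finset.sum_range_succ, Finset.sum_range_succ, hself, hsucc,
      Finset.sum_congr rfl fun j hj => hlt j (Finset.mem_range.1 hj)]
    ring
  | succ n hn ih =>
    rw [Finset.sum_range_succ, hgt n hn, add_right_comm, ih, Finset.sum_range_succ]
    ring

theorem ascentCount_insertMax_succ {n : ℕ} (i : Fin n) (σ : Equiv.Perm (Fin n)) :
    ascentCount (insertMax i.succ σ) + (if IsAscent σ i then 1 else 0) = ascentCount σ + 1 := by
  rw [ascentCount_eq_sum, ascentCount_eq_sum]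
  refine sum_range_succ_add_of_insert (f := fun j => if IsAscent σ j then 1 else 0) i.isLt
    (fun j hj => ?_) (if_pos (isAscent_insertMax_of_succ_eq _ σ (by simp)))
    (if_neg (by exact not_isAscent_insertMax_self i.succ σ)) fun j hj => ?_
  · rw [isAscent_insertMax_of_succ_lt _ σ (by simpa)]
  · rw [isAscent_insertMax_succ _ σ (by simpa using hj)]

theorem sum_ascentCount_insertMax {M : Type*} [AddCommMonoid M] {n : ℕ} (f : ℕ → M)
    (σ : Equiv.Perm (Fin n)) :
    ∑ p, f (ascentCount (insertMax p σ)) =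
      (ascentCount σ + 1) • f (ascentCount σ) + (n - ascentCount σ) • f (ascentCount σ + 1) := by
  have h (i : Fin n) : f (ascentCount (insertMax i.succ σ)) =
      if IsAscent σ i then f (ascentCount σ) else f (ascentCount σ + 1) := by
    have := ascentCount_insertMax_succ i σ
    split_ifs at this ⊢ with hi
    · rw [Nat.add_right_cancel this]
    · rw [← this, add_zero]
  have hcard : ((Finset.range n).filter (IsAscent σ)).card = ascentCount σ := by
    rw [ascentCount_eq_sum, Finset.card_filter]
  have hcard' : ((Finset.range n).filter (¬ IsAscent σ ·)).card = n - ascentCount σ := by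
    have := Finset.card_filter_add_card_filter_not (s := Finset.range n) (IsAscent σ)
    rw [hcard, Finset.card_range] at this
    omega
  simp_rw [Fin.sum_univ_succ, ascentCount_insertMax_zero, h]
  rw [Fin.sum_univ_eq_sum_range
      (fun i => if IsAscent σ i then f (ascentCount σ) else f (ascentCount σ + 1)) n,
    Finset.sum_ite, Finset.sum_const, Finset.sum_const, hcard, hcard', succ_nsmul', add_assoc]

/-- The generating polynomial of permutations by number of ascents. -/
noncomputable def ascentPoly (n : ℕ) : ℝ[X] :=
  ∑ σ : Equiv.Perm (Fin n), X ^ ascentCount σ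

theorem eval_ascentPoly (n : ℕ) (t : ℝ) : (ascentPoly n).eval t = eulerianPoly n t := by
  rw [ascentPoly, eval_finsetSum, eulerianPoly]
  simp_rw [eval_pow, eval_X]
  split_ifs with hn
  · subst hn
    simp [ascentCount]
  · rw [← Finset.sum_fiberwise_of_maps_to (t := Finset.range n) (g := ascentCount)
      fun σ _ => Finset.mem_range.2 (by have := ascentCount_le σ; omega)]
    refine Finset.sum_congr rfl fun k _ => ?_
    rw [Finset.sum_congr rfl fun σ hσ => by rw [(Finset.mem_filter.1 hσ).2], Finset.sum_const,
      nsmul_eq_mul, eulerian]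

theorem ascentPoly_zero : ascentPoly 0 = 1 := by
  simp [ascentPoly, ascentCount]

theorem ascentPoly_succ (n : ℕ) :
    ascentPoly (n + 1) =
      (1 + (n : ℝ[X]) * X) * ascentPoly n + X * (1 - X) * derivative (ascentPoly n) := by
  rw [ascentPoly, ← (insertMax_bijective n).sum_comp, Fintype.sum_prod_type_right, ascentPoly,
    derivative_sum, Finset.mul_sum, Finset.mul_sum, ← Finset.sum_add_distrib]
  refine Finset.sum_congr rfl fun σ _ => ?_
  rw [sum_ascentCount_insertMax (fun k => (X : ℝ[X]) ^ k)]
  have hle : ascentCount σ ≤ n := (ascentCount_le σ).trans (Nat.sub_le _ _)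
  rw [nsmul_eq_mul, nsmul_eq_mul, Nat.cast_sub hle, derivative_X_pow]
  rcases ascentCount σ with _ | k
  · simp
  · simp only [Nat.add_sub_cancel, map_natCast]
    push_cast
    ring

theorem genEulerian_eq_zero (a d : ℝ) (n : ℕ) {k : ℤ} (hk : (n : ℤ) ≤ k ∨ k ≤ -2) :
    genEulerian a d n k = 0 := by
  cases n with
  | zero => rw [genEulerian, if_neg (by push_cast at hk; omega)]
  | succ n => rw [genEulerian, if_pos (by push_cast at hk; omega)]

theorem genEulerian_succ (a d : ℝ) (n : ℕ) (k : ℤ) :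
    genEulerian a d (n + 1) k = (-a + ((k : ℝ) + 2) * d) * genEulerian a d n k
        + (a + (((n : ℝ) + 1) - (k : ℝ) - 1) * d) * genEulerian a d n (k - 1) := by
  rw [genEulerian]
  split_ifs with h
  · rw [genEulerian_eq_zero a d n (k := k) (by omega),
      genEulerian_eq_zero a d n (k := k - 1) (by omega)]
    simp
  · rfl

/-- The general Eulerian polynomial as an element of `ℝ[X]`. -/
noncomputable def genEulerianPolynomial (a d : ℝ) (n : ℕ) : ℝ[X] :=
  ∑ k ∈ Finset.range (n + 1), C (genEulerian a d n ((k : ℤ) - 1)) * X ^ k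

theorem eval_genEulerianPolynomial (a d : ℝ) (n : ℕ) (t : ℝ) :
    (genEulerianPolynomial a d n).eval t = genEulerianPoly n t a d := by
  simp [genEulerianPolynomial, genEulerianPoly, eval_finsetSum]

theorem coeff_genEulerianPolynomial (a d : ℝ) (n m : ℕ) :
    (genEulerianPolynomial a d n).coeff m = genEulerian a d n ((m : ℤ) - 1) := by
  simp only [genEulerianPolynomial, finsetSum_coeff, coeff_C_mul_X_pow, Finset.sum_ite_eq,
    Finset.mem_range]
  split_ifs with h
  · rfl
  · rw [genEulerian_eq_zero a d n (by omega)]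

theorem genEulerianPolynomial_zero (a d : ℝ) : genEulerianPolynomial a d 0 = 1 := by
  simp [genEulerianPolynomial, genEulerian]

theorem genEulerianPolynomial_succ (a d : ℝ) (n : ℕ) :
    genEulerianPolynomial a d (n + 1) =
      (C a * X - C a + C d + C d * (n : ℝ[X]) * X) * genEulerianPolynomial a d n
        + C d * X * (1 - X) * derivative (genEulerianPolynomial a d n) := by
  set T := genEulerianPolynomial a d n with hT
  have hrw : (C a * X - C a + C d + C d * (n : ℝ[X]) * X) * T + C d * X * (1 - X) * derivative T =
      C (d - a) * T + C (a + d * n) * (X * T) + C d * (X * derivative T)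
        - C d * (X * (X * derivative T)) := by
    simp only [map_sub, map_add, map_mul, map_natCast]
    ring
  rw [hrw]
  ext m
  simp only [coeff_add, coeff_sub, coeff_C_mul, coeff_genEulerianPolynomial, genEulerian_succ]
  rcases m with _ | _ | m
  · simp only [coeff_X_mul_zero, hT, coeff_genEulerianPolynomial]
    rw [genEulerian_eq_zero a d n (k := ((0 : ℕ) : ℤ) - 1 - 1) (by simp)]
    push_cast
    ring
  · simp only [coeff_X_mul, coeff_X_mul_zero, coeff_derivative, hT, coeff_genEulerianPolynomial]
    push_cast
    ring_nf
  · simp only [coeff_X_mul, coeff_derivative, hT, coeff_genEulerianPolynomial]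
    push_cast
    rw [show (m : ℤ) + 1 + 1 - 1 - 1 = m + 1 - 1 by ring]
    ring

theorem genEulerianPolynomial_eq_sum (a d : ℝ) (n : ℕ) :
    genEulerianPolynomial a d n =
      ∑ j ∈ Finset.range (n + 1),
        (n.choose j : ℝ[X]) * (C d ^ j * ascentPoly j * (C a * X - C a) ^ (n - j)) := by
  induction n with
  | zero => simp [genEulerianPolynomial_zero, ascentPoly_zero]
  | succ n ih =>
    rw [genEulerianPolynomial_succ, ih, derivative_sum, Finset.mul_sum, Finset.mul_sum,
      ← Finset.sum_add_distrib,
      Finset.sum_choose_succ_mul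
        (fun j m => C d ^ j * ascentPoly j * (C a * X - C a) ^ m), ← Finset.sum_add_distrib]
    refine Finset.sum_congr rfl fun j hj => ?_
    obtain ⟨m, rfl⟩ := Nat.exists_eq_add_of_le (Finset.mem_range_succ_iff.1 hj)
    rw [ascentPoly_succ, show j + m - j = m by omega, show j + m + 1 - j = m + 1 by omega]
    have hpow : (X - 1) * derivative ((C a * X - C a) ^ m) =
        (m : ℝ[X]) * (C a * X - C a) ^ m := by
      rcases m with _ | m
      · simp
      · simp only [derivative_pow, map_sub, derivative_C_mul, derivative_X, derivative_C,
          Nat.add_sub_cancel, map_natCast]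
        ring
    simp only [derivative_mul, derivative_natCast, ← C_pow, derivative_C, pow_succ]
    push_cast
    linear_combination
      (-(((j + m).choose j : ℕ) : ℝ[X]) * C d * C (d ^ j) * X * ascentPoly j) * hpow

/-- `T_n(t,a,d) = ∑_{j=0}^n C(n,j) d^j A_j(t) (at-a)^{n-j}`, relating the general
Eulerian polynomials to the traditional Eulerian polynomials. -/
theorem genEulerianPoly_eq_sum (a d : ℝ) (n : ℕ) (t : ℝ) :
    genEulerianPoly n t a d =
      ∑ j ∈ Finset.range (n + 1),
        (n.choose j : ℝ) * d ^ j * eulerianPoly j t * (a * t - a) ^ (n - j) := by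
  rw [← eval_genEulerianPolynomial, genEulerianPolynomial_eq_sum, eval_finsetSum]
  refine Finset.sum_congr rfl fun j _ => ?_
  simp [eval_ascentPoly, mul_assoc]
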